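/- Let Y be a nonnegative integrable random variable with continuous cumulative distribution function F, mean μ = E[Y] > 0, and Y·F(Y) integrable, and let Y' be an independent copy of Y. Then E|Y − Y'| = 4·E[Y·F(Y)] − 2μ; consequently Sen's formulation of the Gini index, G = 2γ/μ − 1 with γ = E[Y·F(Y)], coincides with the mean-absolute-difference formulation G = E|Y − Y'|/(2μ). -/

import Mathlib

open MeasureTheory ProbabilityTheory

/-- A probability measure on `ℝ` with continuous cumulative distribution function has no atoms. -/
theorem nullSingletonClass_of_continuous_cdf (ν : Measure ℝ) [IsProbabilityMeasure ν]
    (h : Continuous (cdf ν)) : NullSingletonClass ν := by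
  refine ⟨fun x => ?_⟩
  rw [← measure_cdf ν, StieltjesFunction.measure_singleton,
    h.continuousAt.continuousWithinAt.leftLim_eq, sub_self, ENNReal.ofReal_zero]

/-- The mean absolute difference of an atomless probability measure in terms of its cumulative
distribution function. -/
theorem integral_abs_sub_prod_self (ν : Measure ℝ) [IsProbabilityMeasure ν] [NullSingletonClass ν]
    (hint : Integrable (fun x : ℝ => x) ν) :
    ∫ p : ℝ × ℝ, |p.1 - p.2| ∂(ν.prod ν) =
      4 * ∫ x, x * ν.real (Set.Iic x) ∂ν - 2 * ∫ x, x ∂ν := by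
  have hle : MeasurableSet {p : ℝ × ℝ | p.2 ≤ p.1} := measurableSet_le measurable_snd measurable_fst
  have hlt : MeasurableSet {p : ℝ × ℝ | p.1 < p.2} := measurableSet_lt measurable_fst measurable_snd
  have h1 : Integrable (fun p : ℝ × ℝ => p.1) (ν.prod ν) := hint.comp_fst ν
  have h2 : Integrable (fun p : ℝ × ℝ => p.2) (ν.prod ν) := hint.comp_snd ν
  have i1 := h1.indicator hle
  have i2 := h2.indicator hlt
  have e1 : ∫ p, {p : ℝ × ℝ | p.2 ≤ p.1}.indicator (fun p => p.1) p ∂(ν.prod ν) =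
      ∫ x, x * ν.real (Set.Iic x) ∂ν := by
    rw [integral_prod _ i1]
    refine integral_congr_ae (.of_forall fun x => ?_)
    have : (fun y => {p : ℝ × ℝ | p.2 ≤ p.1}.indicator (fun p => p.1) (x, y)) =
        (Set.Iic x).indicator fun _ => x := by
      ext y; simp [Set.indicator]
    simp only [this]
    rw [integral_indicator_const _ measurableSet_Iic, smul_eq_mul, mul_comm]
  have e2 : ∫ p, {p : ℝ × ℝ | p.1 < p.2}.indicator (fun p => p.2) p ∂(ν.prod ν) =
      ∫ x, x * ν.real (Set.Iic x) ∂ν := by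
    rw [integral_prod_symm _ i2]
    refine integral_congr_ae (.of_forall fun y => ?_)
    have : (fun x => {p : ℝ × ℝ | p.1 < p.2}.indicator (fun p => p.2) (x, y)) =
        (Set.Iio y).indicator fun _ => y := by
      ext x; simp [Set.indicator]
    simp only [this]
    rw [integral_indicator_const _ measurableSet_Iio, smul_eq_mul, mul_comm,
      measureReal_congr Iio_ae_eq_Iic]
  have e3 : ∫ p : ℝ × ℝ, p.1 ∂(ν.prod ν) = ∫ x, x ∂ν := by
    simpa using integral_fun_fst (μ := ν) (ν := ν) (fun x : ℝ => x)
  have e4 : ∫ p : ℝ × ℝ, p.2 ∂(ν.prod ν) = ∫ x, x ∂ν := by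
    simpa using integral_fun_snd (μ := ν) (ν := ν) (fun x : ℝ => x)
  have key : ∀ p : ℝ × ℝ, |p.1 - p.2| =
      2 * ({p : ℝ × ℝ | p.2 ≤ p.1}.indicator (fun p => p.1) p +
        {p : ℝ × ℝ | p.1 < p.2}.indicator (fun p => p.2) p) - (p.1 + p.2) := by
    rintro ⟨x, y⟩
    rcases le_or_gt y x with h | h
    · simp only [Set.indicator, Set.mem_ofPred_eq, h, h.not_gt, if_true, if_false,
        abs_of_nonneg (sub_nonneg.2 h)]
      ring
    · simp only [Set.indicator, Set.mem_ofPred_eq, h, h.not_ge, if_true, if_false,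
        abs_of_neg (sub_neg.2 h)]
      ring
  simp_rw [key]
  rw [integral_sub (by exact (i1.add i2).const_mul 2) (by exact h1.add h2), integral_const_mul,
    integral_add i1 i2, integral_add h1 h2, e1, e2, e3, e4]
  ring

/-- For a nonnegative integrable random variable `Y` with continuous cdf `F`,
mean `μ = E[Y] > 0`, `Y·F(Y)` integrable, and `Y'` an independent copy of `Y`:
`E|Y − Y'| = 4·E[Y·F(Y)] − 2μ`; consequently Sen's form of the Gini index,
`G = 2γ/μ − 1` with `γ = E[Y·F(Y)]`, coincides with the mean-absolute-difference
form `G = E|Y − Y'|/(2μ)`. -/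
theorem sen_gini_eq_mean_abs_difference
    {Ω : Type*} [MeasureSpace Ω] [IsProbabilityMeasure (ℙ : Measure Ω)]
    (Y Y' : Ω → ℝ) (hYmeas : Measurable Y) (hY'meas : Measurable Y')
    (hYnonneg : ∀ᵐ ω ∂(ℙ : Measure Ω), 0 ≤ Y ω)
    (hYint : Integrable Y (ℙ : Measure Ω))
    (hindep : IndepFun Y Y' (ℙ : Measure Ω))
    (hident : IdentDistrib Y' Y (ℙ : Measure Ω) (ℙ : Measure Ω))
    (F : ℝ → ℝ)
    (hF : ∀ x, F x = ((Measure.map Y (ℙ : Measure Ω)) (Set.Iic x)).toReal)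
    (hFcont : Continuous F)
    (μ γ : ℝ) (hμ : μ = ∫ ω, Y ω ∂(ℙ : Measure Ω)) (hμpos : 0 < μ)
    (hγ : γ = ∫ ω, Y ω * F (Y ω) ∂(ℙ : Measure Ω))
    (hYF_int : Integrable (fun ω => Y ω * F (Y ω)) (ℙ : Measure Ω)) :
    (∫ ω, |Y ω - Y' ω| ∂(ℙ : Measure Ω)) = 4 * γ - 2 * μ ∧
      2 * γ / μ - 1 = (∫ ω, |Y ω - Y' ω| ∂(ℙ : Measure Ω)) / (2 * μ) := by
  set ν := Measure.map Y (ℙ : Measure Ω) with hν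
  have : IsProbabilityMeasure ν := Measure.isProbabilityMeasure_map hYmeas.aemeasurable
  have hFν : ∀ x, F x = ν.real (Set.Iic x) := hF
  have hcdf : ⇑(cdf ν) = F := funext fun x => by rw [cdf_eq_real, hFν]
  have : NullSingletonClass ν := nullSingletonClass_of_continuous_cdf ν (hcdf ▸ hFcont)
  have hint : Integrable (fun x : ℝ => x) ν :=
    (integrable_map_measure measurable_id.aestronglyMeasurable hYmeas.aemeasurable).2 hYint
  have hjoint : Measure.map (fun ω => (Y ω, Y' ω)) (ℙ : Measure Ω) = ν.prod ν := by
    rw [(indepFun_iff_map_prod_eq_prod_map_map hYmeas.aemeasurable hY'meas.aemeasurable).1 hindep,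
      hident.map_eq]
  have hμ' : ∫ x, x ∂ν = μ := by
    rw [hμ, hν]
    exact integral_map hYmeas.aemeasurable measurable_id.aestronglyMeasurable
  have hγ' : ∫ x, x * ν.real (Set.Iic x) ∂ν = γ := by
    simp_rw [← hFν]
    rw [hγ, hν]
    exact integral_map hYmeas.aemeasurable
      (continuous_id.mul hFcont).measurable.aestronglyMeasurable
  have hmain : (∫ ω, |Y ω - Y' ω| ∂(ℙ : Measure Ω)) = 4 * γ - 2 * μ := by
    rw [← hμ', ← hγ', ← integral_abs_sub_prod_self ν hint, ← hjoint]
    exact (integral_map (hYmeas.prodMk hY'meas).aemeasurable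
      (continuous_fst.sub continuous_snd).abs.measurable.aestronglyMeasurable).symm
  refine ⟨hmain, ?_⟩
  rw [hmain]
  field_simp
  ring
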